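/- arXiv:1511.03132 — 3 statements merged into one kernel-verified Lean document; each statement's English description precedes it below -/
import Mathlib

section
/- For every natural number n ≥ 3 and every k, the k-th Betti number of the Lie algebra m0(n) over F equals the k-th Betti number of the Lie algebra m2(n) over F, i.e., dim H^k(m0(n)) = dim H^k(m2(n)), where H^k denotes Chevalley–Eilenberg cohomology with trivial coefficients. -/
/-!
STATEMENT 0: For every n ≥ 3 and every k, the k-th Betti number of m0(n) over a field F
of characteristic two equals the k-th Betti number of m2(n):
dim H^k(m0(n)) = dim H^k(m2(n)) (Chevalley–Eilenberg cohomology, trivial coefficients).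

In characteristic two the Chevalley–Eilenberg complex of alternating forms is (canonically)
the exterior algebra Λ*(e^1,…,e^n) of the dual space, with differential the derivation
determined by its values on the degree-one generators (no signs occur).  For m0(n):
d(e^1)=d(e^2)=0, d(e^i)=e^1∧e^{i−1} (3 ≤ i ≤ n); for m2(n): d(e^1)=d(e^2)=0,
d(e^i)=e^1∧e^{i−1} (i=3,4), d(e^i)=e^1∧e^{i−1}+e^2∧e^{i−2} (5 ≤ i ≤ n).
H^k = Z^k / B^k with Z^k = Λ^k ∩ ker d and B^k = d(Λ^{k−1}).
-/

noncomputable section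
namespace Char2Filiform

/-- The exterior algebra of the dual space, Λ*(e^1,…,e^N). -/
abbrev XA (F : Type*) [Field F] (N : ℕ) := ExteriorAlgebra F (Fin N → F)

/-- The generator `e^{i+1}` (zero-indexed). -/
def gen (F : Type*) [Field F] (N : ℕ) (i : Fin N) : XA F N :=
  ExteriorAlgebra.ι F (Pi.single i (1 : F))

/-- Derivation property (no signs since the base field has characteristic two). -/
def IsDeriv (F : Type*) [Field F] (N : ℕ) (D : XA F N →ₗ[F] XA F N) : Prop :=
  ∀ a b : XA F N, D (a * b) = D a * b + a * D b

/-- The subspace `Λ^k(e^1,…,e^N)` of forms of topological degree `k`. -/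
def grade (F : Type*) [Field F] (N : ℕ) (k : ℕ) : Submodule F (XA F N) :=
  (LinearMap.range (ExteriorAlgebra.ι F (M := Fin N → F))) ^ k

/-- `d` is the Chevalley–Eilenberg differential of `m0(N)`. -/
def Isd0 (F : Type*) [Field F] (N : ℕ) (d : XA F N →ₗ[F] XA F N) : Prop :=
  IsDeriv F N d ∧
  (∀ i : Fin N, (i : ℕ) ≤ 1 → d (gen F N i) = 0) ∧
  (∀ m : ℕ, (h : m + 3 ≤ N) →
    d (gen F N ⟨m + 2, by omega⟩) = gen F N ⟨0, by omega⟩ * gen F N ⟨m + 1, by omega⟩)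

/-- `d` is the Chevalley–Eilenberg differential of `m2(N)`. -/
def Isd2 (F : Type*) [Field F] (N : ℕ) (d : XA F N →ₗ[F] XA F N) : Prop :=
  IsDeriv F N d ∧
  (∀ i : Fin N, (i : ℕ) ≤ 1 → d (gen F N i) = 0) ∧
  (∀ m : ℕ, (h : m + 3 ≤ N) → m ≤ 1 →
    d (gen F N ⟨m + 2, by omega⟩) = gen F N ⟨0, by omega⟩ * gen F N ⟨m + 1, by omega⟩) ∧
  (∀ m : ℕ, (h : m + 5 ≤ N) →
    d (gen F N ⟨m + 4, by omega⟩) =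
      gen F N ⟨0, by omega⟩ * gen F N ⟨m + 3, by omega⟩ +
      gen F N ⟨1, by omega⟩ * gen F N ⟨m + 2, by omega⟩)

/-- The space of `k`-cocycles `Z^k = Λ^k ∩ ker d`. -/
def cocycles (F : Type*) [Field F] (N : ℕ) (d : XA F N →ₗ[F] XA F N) (k : ℕ) :
    Submodule F (XA F N) :=
  grade F N k ⊓ LinearMap.ker d

/-- The space of `k`-coboundaries `B^k = d(Λ^{k-1})` (with `B^0 = d(Λ^0) = 0`). -/
def coboundaries (F : Type*) [Field F] (N : ℕ) (d : XA F N →ₗ[F] XA F N) (k : ℕ) :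
    Submodule F (XA F N) :=
  Submodule.map d (grade F N (k - 1))

/-- The `k`-th Betti number `b_k = dim H^k = dim (Z^k / B^k)`. -/
def bettiNumber (F : Type*) [Field F] (N : ℕ) (d : XA F N →ₗ[F] XA F N) (k : ℕ) : ℕ :=
  Module.finrank F
    (↥(cocycles F N d k) ⧸
      Submodule.comap (cocycles F N d k).subtype (coboundaries F N d k))

/-- An exterior algebra over a field of characteristic two has characteristic two. -/
theorem charP_two_XA (F : Type*) [Field F] [CharP F 2] (n : ℕ) : CharP (XA F n) 2 :=
  charP_of_injective_algebraMap (FaithfulSMul.algebraMap_injective F (XA F n)) 2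

section Derivations

variable {F : Type*} [Field F] {n : ℕ}

theorem IsDeriv.map_one {D : XA F n →ₗ[F] XA F n} (hD : IsDeriv F n D) : D 1 = 0 := by
  simpa using hD 1 1

theorem IsDeriv.map_algebraMap {D : XA F n →ₗ[F] XA F n} (hD : IsDeriv F n D) (r : F) :
    D (algebraMap F _ r) = 0 := by
  rw [Algebra.algebraMap_eq_smul_one, map_smul, hD.map_one, smul_zero]

theorem ι_eq_sum_gen (v : Fin n → F) :
    ExteriorAlgebra.ι F v = ∑ i, v i • gen F n i := by
  conv_lhs => rw [pi_eq_sum_univ' v]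
  simp only [map_sum, map_smul, gen]

theorem IsDeriv.ext_gen {D E : XA F n →ₗ[F] XA F n} (hD : IsDeriv F n D) (hE : IsDeriv F n E)
    (h : ∀ i, D (gen F n i) = E (gen F n i)) : D = E := by
  refine LinearMap.ext fun x => ?_
  induction x using ExteriorAlgebra.induction with
  | algebraMap r => rw [hD.map_algebraMap, hE.map_algebraMap]
  | ι v => simp only [ι_eq_sum_gen, map_sum, map_smul, h]
  | mul a b ha hb => rw [hD, hE, ha, hb]
  | add a b ha hb => rw [map_add, map_add, ha, hb]

theorem gen_mem_grade_one (i : Fin n) : gen F n i ∈ grade F n 1 := by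
  rw [grade, pow_one]
  exact LinearMap.mem_range_self _ _

theorem mul_mem_grade {j k : ℕ} {a b : XA F n} (ha : a ∈ grade F n j) (hb : b ∈ grade F n k) :
    a * b ∈ grade F n (j + k) := by
  rw [grade, pow_add]
  exact Submodule.mul_mem_mul ha hb

theorem IsDeriv.map_mem_grade {D : XA F n →ₗ[F] XA F n} (hD : IsDeriv F n D)
    (h : ∀ i, D (gen F n i) ∈ grade F n 2) (k : ℕ) :
    ∀ a ∈ grade F n k, D a ∈ grade F n (k + 1) := by
  induction k with
  | zero =>
    intro a ha
    rw [grade, pow_zero] at ha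
    obtain ⟨r, rfl⟩ := Submodule.mem_one.mp ha
    rw [hD.map_algebraMap]
    exact zero_mem _
  | succ k ih =>
    intro a ha
    rw [grade, pow_succ] at ha
    refine Submodule.mul_induction_on ha ?_ fun x y hx hy => ?_
    · rintro b hb _ ⟨v, rfl⟩
      rw [hD]
      refine add_mem ?_ ?_
      · refine mul_mem_grade (k := 1) (ih b hb) ?_
        rw [grade, pow_one]
        exact LinearMap.mem_range_self _ _
      · refine mul_mem_grade (k := 2) hb ?_
        rw [ι_eq_sum_gen, map_sum]
        exact sum_mem fun i _ => by rw [map_smul]; exact Submodule.smul_mem _ _ (h i)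
    · rw [map_add]
      exact add_mem hx hy

theorem gen_mul_self (i : Fin n) : gen F n i * gen F n i = 0 :=
  ExteriorAlgebra.ι_sq_zero _

theorem IsDeriv.map_gen_mul {D : XA F n →ₗ[F] XA F n} (hD : IsDeriv F n D) {i : Fin n}
    (h : D (gen F n i) = 0) (a : XA F n) : D (gen F n i * a) = gen F n i * D a := by
  rw [hD, h, zero_mul, zero_add]

theorem Isd0.map_mem_grade {d : XA F n →ₗ[F] XA F n} (hd : Isd0 F n d) {k : ℕ} {a : XA F n}
    (ha : a ∈ grade F n k) : d a ∈ grade F n (k + 1) := by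
  refine hd.1.map_mem_grade (fun i => ?_) k a ha
  obtain ⟨i, hi⟩ := i
  rcases Nat.lt_or_ge 1 i with h | h
  · obtain ⟨m, rfl⟩ := Nat.exists_eq_add_of_le' h
    rw [hd.2.2 m hi]
    exact mul_mem_grade (gen_mem_grade_one _) (gen_mem_grade_one _)
  · rw [hd.2.1 _ h]
    exact zero_mem _

/-- Contraction with the `i`-th coordinate vector. -/
def contr (F : Type*) [Field F] (n : ℕ) (i : Fin n) : XA F n →ₗ[F] XA F n :=
  CliffordAlgebra.contractLeft (LinearMap.proj i)

theorem contr_ι_mul (i : Fin n) (v : Fin n → F) (a : XA F n) :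
    contr F n i (ExteriorAlgebra.ι F v * a) =
      v i • a - ExteriorAlgebra.ι F v * contr F n i a :=
  CliffordAlgebra.contractLeft_ι_mul _ _ _

theorem contr_ι (i : Fin n) (v : Fin n → F) :
    contr F n i (ExteriorAlgebra.ι F v) = algebraMap F _ (v i) :=
  CliffordAlgebra.contractLeft_ι _ _ _

theorem contr_algebraMap (i : Fin n) (r : F) : contr F n i (algebraMap F _ r) = 0 :=
  CliffordAlgebra.contractLeft_algebraMap _ _ _

theorem contr_gen (i j : Fin n) :
    contr F n i (gen F n j) = if i = j then 1 else 0 := by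
  rw [gen, contr_ι, Pi.single_apply]
  split_ifs <;> simp

theorem contr_contr (i : Fin n) (a : XA F n) : contr F n i (contr F n i a) = 0 :=
  CliffordAlgebra.contractLeft_contractLeft _ _

theorem contr_mem_grade (i : Fin n) (k : ℕ) :
    ∀ a ∈ grade F n (k + 1), contr F n i a ∈ grade F n k := by
  induction k with
  | zero =>
    intro a ha
    rw [grade, zero_add, pow_one] at ha
    obtain ⟨v, rfl⟩ := ha
    rw [contr_ι, grade, pow_zero]
    exact Submodule.algebraMap_mem _
  | succ k ih =>
    intro a ha
    rw [grade, pow_succ'] at ha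
    refine Submodule.mul_induction_on ha ?_ fun x y hx hy => ?_
    · rintro _ ⟨v, rfl⟩ b hb
      rw [contr_ι_mul]
      refine sub_mem (Submodule.smul_mem _ _ hb) ?_
      rw [grade, pow_succ']
      exact Submodule.mul_mem_mul (LinearMap.mem_range_self _ _) (ih b hb)
    · rw [map_add]
      exact add_mem hx hy

variable [CharP F 2]

theorem XA.neg_eq (a : XA F n) : -a = a :=
  have := charP_two_XA F n
  CharTwo.neg_eq a

theorem XA.add_self (a : XA F n) : a + a = 0 :=
  have := charP_two_XA F n
  CharTwo.add_self_eq_zero a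

theorem gen_comm (i : Fin n) (a : XA F n) : gen F n i * a = a * gen F n i := by
  induction a using ExteriorAlgebra.induction with
  | algebraMap r => exact (Algebra.commutes r _).symm
  | ι v =>
    rw [← XA.neg_eq (ExteriorAlgebra.ι F v * gen F n i)]
    exact eq_neg_of_add_eq_zero_left (ExteriorAlgebra.ι_add_mul_swap _ _)
  | mul a b ha hb => rw [← mul_assoc, ha, mul_assoc, hb, mul_assoc]
  | add a b ha hb => rw [mul_add, add_mul, ha, hb]

theorem isDeriv_contr (i : Fin n) : IsDeriv F n (contr F n i) := by
  intro a
  induction a using ExteriorAlgebra.induction with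
  | algebraMap r =>
    intro b
    simp [contr_algebraMap, ← Algebra.smul_def]
  | ι v =>
    intro b
    rw [contr_ι_mul, contr_ι, sub_eq_add_neg, XA.neg_eq, Algebra.smul_def]
  | mul a b ha hb =>
    intro c
    rw [mul_assoc, ha, hb, ha]
    noncomm_ring
  | add a b ha hb =>
    intro c
    rw [add_mul, map_add, ha, hb, map_add]
    noncomm_ring

theorem IsDeriv.comp_add_comp {D E : XA F n →ₗ[F] XA F n} (hD : IsDeriv F n D)
    (hE : IsDeriv F n E) : IsDeriv F n (D ∘ₗ E + E ∘ₗ D) := by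
  intro a b
  simp only [LinearMap.add_apply, LinearMap.comp_apply, hD a b, hE a b, map_add]
  rw [hD, hD, hE, hE]
  calc _ = (D (E a) + E (D a)) * b + a * (D (E b) + E (D b)) +
        ((D a * E b + D a * E b) + (E a * D b + E a * D b)) := by noncomm_ring
    _ = _ := by rw [XA.add_self, XA.add_self, add_zero, add_zero]

theorem IsDeriv.comp_self {D : XA F n →ₗ[F] XA F n} (hD : IsDeriv F n D) :
    IsDeriv F n (D ∘ₗ D) := by
  intro a b
  simp only [LinearMap.comp_apply, hD a b, map_add]
  rw [hD, hD]
  calc _ = D (D a) * b + a * D (D b) + (D a * D b + D a * D b) := by abel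
    _ = _ := by rw [XA.add_self, add_zero]

theorem IsDeriv.gen_mul {D : XA F n →ₗ[F] XA F n} (hD : IsDeriv F n D) (i : Fin n) :
    IsDeriv F n (LinearMap.mulLeft F (gen F n i) ∘ₗ D) := by
  intro a b
  simp only [LinearMap.comp_apply, LinearMap.mulLeft_apply]
  rw [hD, mul_add, ← mul_assoc, ← mul_assoc, gen_comm i a, mul_assoc a]

end Derivations

theorem finrank_quotient_comap_subtype_eq {F V : Type*} [Field F] [AddCommGroup V] [Module F V]
    (e : V ≃ₗ[F] V) {A B A' B' : Submodule F V} (hA : A.map e.toLinearMap = A')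
    (hB : B.map e.toLinearMap = B') :
    Module.finrank F (↥A ⧸ B.comap A.subtype) = Module.finrank F (↥A' ⧸ B'.comap A'.subtype) := by
  subst hA hB
  refine (Submodule.Quotient.equiv _ _ (e.submoduleMap A) ?_).finrank_eq
  ext ⟨y, hy⟩
  obtain ⟨x, hx, rfl⟩ := hy
  simp only [Submodule.mem_map, Submodule.mem_comap, Submodule.subtype_apply]
  constructor
  · rintro ⟨z, hz, hzx⟩
    exact ⟨z, hz, congrArg Subtype.val hzx⟩
  · rintro ⟨z, hz, hzx⟩
    obtain rfl := e.injective hzx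
    exact ⟨⟨z, hx⟩, hz, rfl⟩

/-- A graded automorphism intertwining two differentials identifies their Betti numbers. -/
theorem bettiNumber_eq_of_equiv {F : Type*} [Field F] {n : ℕ} {d d' : XA F n →ₗ[F] XA F n}
    (e : XA F n ≃ₗ[F] XA F n) (hgr : ∀ k, (grade F n k).map e.toLinearMap = grade F n k)
    (he : ∀ a, e (d a) = d' (e a)) (k : ℕ) : bettiNumber F n d k = bettiNumber F n d' k := by
  refine finrank_quotient_comap_subtype_eq e ?_ ?_
  · have hker : (LinearMap.ker d).map e.toLinearMap = LinearMap.ker d' := by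
      ext y
      obtain ⟨x, rfl⟩ := e.surjective y
      simp [← he]
    rw [cocycles, cocycles, Submodule.map_inf _ e.injective, hgr, hker]
  · rw [coboundaries, coboundaries, ← Submodule.map_comp]
    conv_rhs => rw [← hgr (k - 1), ← Submodule.map_comp]
    congr 1
    exact LinearMap.ext he

section Intertwiner

variable {F : Type*} [Field F] {n : ℕ}

/-- The nilpotent operator `a ↦ e^j ∧ ι_i d ι_i a`, where `ι_i` is contraction. -/
def shear (d : XA F n →ₗ[F] XA F n) (i j : Fin n) : XA F n →ₗ[F] XA F n :=
  LinearMap.mulLeft F (gen F n j) ∘ₗ contr F n i ∘ₗ d ∘ₗ contr F n i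

theorem shear_apply (d : XA F n →ₗ[F] XA F n) (i j : Fin n) (a : XA F n) :
    shear d i j a = gen F n j * contr F n i (d (contr F n i a)) := rfl

/-- The Lie derivative `ι_i d + d ι_i`. -/
def lieDeriv (d : XA F n →ₗ[F] XA F n) (i : Fin n) : XA F n →ₗ[F] XA F n :=
  contr F n i ∘ₗ d + d ∘ₗ contr F n i

theorem lieDeriv_apply (d : XA F n →ₗ[F] XA F n) (i : Fin n) (a : XA F n) :
    lieDeriv d i a = contr F n i (d a) + d (contr F n i a) := rfl

theorem lieDeriv_gen {d : XA F n →ₗ[F] XA F n} (hd : IsDeriv F n d) (i j : Fin n) :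
    lieDeriv d i (gen F n j) = contr F n i (d (gen F n j)) := by
  rw [lieDeriv_apply, contr_gen]
  split_ifs <;> simp [hd.map_one]

theorem shear_mem_grade {d : XA F n →ₗ[F] XA F n} (hd : Isd0 F n d) (i j : Fin n) {k : ℕ}
    {a : XA F n} (ha : a ∈ grade F n k) : shear d i j a ∈ grade F n k := by
  cases k with
  | zero =>
    rw [grade, pow_zero] at ha
    obtain ⟨r, rfl⟩ := Submodule.mem_one.mp ha
    simp [shear_apply, contr_algebraMap]
  | succ k =>
    rw [shear_apply, add_comm]
    exact mul_mem_grade (gen_mem_grade_one j)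
      (contr_mem_grade i _ _ (hd.map_mem_grade (contr_mem_grade i _ _ ha)))

variable [CharP F 2]

theorem contr_gen_mul {i j : Fin n} (hij : i ≠ j) (a : XA F n) :
    contr F n i (gen F n j * a) = gen F n j * contr F n i a :=
  (isDeriv_contr i).map_gen_mul (by simp [contr_gen, hij]) a

theorem shear_gen_mul {d : XA F n →ₗ[F] XA F n} (hd : IsDeriv F n d) {i j : Fin n} (hij : i ≠ j)
    (hj : d (gen F n j) = 0) (a : XA F n) : shear d i j (gen F n j * a) = 0 := by
  rw [shear_apply, contr_gen_mul hij, hd.map_gen_mul hj, contr_gen_mul hij, ← mul_assoc,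
    gen_mul_self, zero_mul]

theorem shear_shear {d : XA F n →ₗ[F] XA F n} (hd : IsDeriv F n d) {i j : Fin n} (hij : i ≠ j)
    (hj : d (gen F n j) = 0) (a : XA F n) : shear d i j (shear d i j a) = 0 :=
  shear_gen_mul hd hij hj _

/-- The involution `1 + shear d i j`. -/
def shearEquiv {d : XA F n →ₗ[F] XA F n} (hd : IsDeriv F n d) {i j : Fin n} (hij : i ≠ j)
    (hj : d (gen F n j) = 0) : XA F n ≃ₗ[F] XA F n :=
  LinearEquiv.ofInvolutive (LinearMap.id + shear d i j) fun a => by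
    simp [shear_shear hd hij hj, add_assoc, XA.add_self]

theorem shearEquiv_apply {d : XA F n →ₗ[F] XA F n} (hd : IsDeriv F n d) {i j : Fin n}
    (hij : i ≠ j) (hj : d (gen F n j) = 0) (a : XA F n) :
    shearEquiv hd hij hj a = a + shear d i j a := rfl

theorem map_shearEquiv_grade {d : XA F n →ₗ[F] XA F n} (hd : Isd0 F n d) {i j : Fin n}
    (hij : i ≠ j) (hj : d (gen F n j) = 0) (k : ℕ) :
    (grade F n k).map (shearEquiv hd.1 hij hj).toLinearMap = grade F n k := by
  have hmem : ∀ a ∈ grade F n k, shearEquiv hd.1 hij hj a ∈ grade F n k := fun a ha =>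
    add_mem ha (shear_mem_grade hd i j ha)
  refine le_antisymm (Submodule.map_le_iff_le_comap.mpr hmem) fun a ha => ?_
  exact ⟨_, hmem a ha, (shearEquiv hd.1 hij hj).left_inv a⟩

/-- In characteristic two, `d2 = d0 + e^2 ∧ D ^ 2` with `D` the Lie derivative along `e_1`. -/
theorem d2_apply_eq {d0 d2 : XA F n →ₗ[F] XA F n} (hn : 3 ≤ n) (hd0 : Isd0 F n d0)
    (hd2 : Isd2 F n d2) (a : XA F n) :
    d2 a = d0 a + gen F n ⟨1, by omega⟩ *
      lieDeriv d0 ⟨0, by omega⟩ (lieDeriv d0 ⟨0, by omega⟩ a) := by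
  have hL : IsDeriv F n (lieDeriv d0 ⟨0, by omega⟩) := (isDeriv_contr _).comp_add_comp hd0.1
  have hlow : ∀ i : Fin n, (i : ℕ) ≤ 1 → lieDeriv d0 ⟨0, by omega⟩ (gen F n i) = 0 := fun i hi => by
    rw [lieDeriv_gen hd0.1, hd0.2.1 i hi, map_zero]
  have hhigh : ∀ m : ℕ, (h : m + 3 ≤ n) →
      lieDeriv d0 ⟨0, by omega⟩ (gen F n ⟨m + 2, by omega⟩) = gen F n ⟨m + 1, by omega⟩ := by
    intro m h
    rw [lieDeriv_gen hd0.1, hd0.2.2 m h, isDeriv_contr, contr_gen, contr_gen]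
    simp
  have hE := hL.comp_self.gen_mul ⟨1, by omega⟩
  have hsum : IsDeriv F n (d0 + LinearMap.mulLeft F (gen F n ⟨1, by omega⟩) ∘ₗ
      lieDeriv d0 ⟨0, by omega⟩ ∘ₗ lieDeriv d0 ⟨0, by omega⟩) := by
    intro x y
    rw [LinearMap.add_apply, hd0.1, hE]
    simp only [LinearMap.add_apply]
    noncomm_ring
  refine LinearMap.congr_fun (hd2.1.ext_gen hsum fun i => ?_) a
  simp only [LinearMap.add_apply, LinearMap.comp_apply, LinearMap.mulLeft_apply]
  obtain ⟨i, hi⟩ := i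
  match i, hi with
  | 0, hi => rw [hd2.2.1 _ (by simp), hd0.2.1 _ (by simp), hlow _ (by simp)]; simp
  | 1, hi => rw [hd2.2.1 _ (by simp), hd0.2.1 _ (by simp), hlow _ (by simp)]; simp
  | 2, hi =>
    rw [hd2.2.2.1 0 hi (by simp), hd0.2.2 0 hi, hhigh 0 hi, hlow _ (by simp)]
    simp
  | 3, hi =>
    rw [hd2.2.2.1 1 hi le_rfl, hd0.2.2 1 hi, hhigh 1 hi, hhigh 0 (by omega), gen_mul_self, add_zero]
  | m + 4, hi =>
    rw [hd2.2.2.2 m hi, hd0.2.2 (m + 2) hi, hhigh (m + 2) hi, hhigh (m + 1) (by omega)]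

theorem shearEquiv_intertwines {d : XA F n →ₗ[F] XA F n} (hd : IsDeriv F n d) {i j : Fin n}
    (hij : i ≠ j) (hj : d (gen F n j) = 0) (hsq : ∀ a, d (d a) = 0) (a : XA F n) :
    shearEquiv hd hij hj (d a) =
      d (shearEquiv hd hij hj a) +
        gen F n j * lieDeriv d i (lieDeriv d i (shearEquiv hd hij hj a)) := by
  have hL : IsDeriv F n (lieDeriv d i) := (isDeriv_contr _).comp_add_comp hd
  have hLj : lieDeriv d i (gen F n j) = 0 := by rw [lieDeriv_gen hd, hj, map_zero]
  have hLL : ∀ b, lieDeriv d i (lieDeriv d i b) =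
      contr F n i (d (contr F n i (d b))) + d (contr F n i (d (contr F n i b))) := by
    intro b
    simp only [lieDeriv_apply, map_add, hsq, contr_contr, map_zero, add_zero, zero_add]
  have hzero : gen F n j * lieDeriv d i (lieDeriv d i (shear d i j a)) = 0 := by
    rw [shear_apply, hL.map_gen_mul hLj, hL.map_gen_mul hLj, ← mul_assoc, gen_mul_self, zero_mul]
  simp only [shearEquiv_apply, map_add, mul_add, hzero]
  rw [shear_apply, shear_apply, hd.map_gen_mul hj, hLL, mul_add]
  set y := gen F n j * d (contr F n i (d (contr F n i a)))
  set z := gen F n j * contr F n i (d (contr F n i (d a)))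
  calc d a + z = d a + z + (y + y) := by rw [XA.add_self, add_zero]
    _ = d a + y + (z + y + 0) := by abel

end Intertwiner

theorem betti_m0_eq_betti_m2 (F : Type*) [Field F] [CharP F 2] (n : ℕ) (hn : 3 ≤ n)
    (d0 d2 : XA F n →ₗ[F] XA F n)
    (hd0 : Isd0 F n d0) (hd2 : Isd2 F n d2)
    (hd0sq : ∀ a, d0 (d0 a) = 0) (hd2sq : ∀ a, d2 (d2 a) = 0) :
    ∀ k : ℕ, bettiNumber F n d0 k = bettiNumber F n d2 k := by
  have hij : (⟨0, by omega⟩ : Fin n) ≠ ⟨1, by omega⟩ := by simp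
  have hj : d0 (gen F n ⟨1, by omega⟩) = 0 := hd0.2.1 _ le_rfl
  refine bettiNumber_eq_of_equiv (shearEquiv hd0.1 hij hj) (map_shearEquiv_grade hd0 hij hj) ?_
  intro a
  rw [d2_apply_eq hn hd0 hd2, shearEquiv_intertwines hd0.1 hij hj hd0sq]

end Char2Filiform
end
end

section
/- For every element ω of the exterior algebra Λ*(e^1,…,e^n), one has e^2 ∧ D2(ω) = e^2 ∧ D1(D1(ω)). -/
/-!
STATEMENT 2: For every element ω of the exterior algebra Λ*(e^1,…,e^n), one has
e^2 ∧ D2(ω) = e^2 ∧ D1(D1(ω)), where F has characteristic two, D1 is the derivation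
with D1(e^1)=D1(e^2)=0, D1(e^i)=e^{i−1} (i≥3), and D2 is the derivation with
D2(e^i)=0 (i≤4), D2(e^i)=e^{i−2} (i≥5).

We model Λ*(e^1,…,e^n) as the exterior algebra on `Fin n → F`; `gen F n i` is the
paper's generator `e^{i+1}` (zero-indexed).
-/

noncomputable section
namespace Char2Filiform

/-- `D` is the derivation `D1`: `D1 e^1 = D1 e^2 = 0`, `D1 e^i = e^{i-1}` for `i ≥ 3`. -/
def IsD1 (F : Type*) [Field F] (N : ℕ) (D : XA F N →ₗ[F] XA F N) : Prop :=
  IsDeriv F N D ∧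
  (∀ i : Fin N, (i : ℕ) ≤ 1 → D (gen F N i) = 0) ∧
  (∀ m : ℕ, (h : m + 3 ≤ N) → D (gen F N ⟨m + 2, by omega⟩) = gen F N ⟨m + 1, by omega⟩)

/-- `D` is the derivation `D2`: `D2 e^i = 0` for `i ≤ 4`, `D2 e^i = e^{i-2}` for `i ≥ 5`. -/
def IsD2 (F : Type*) [Field F] (N : ℕ) (D : XA F N →ₗ[F] XA F N) : Prop :=
  IsDeriv F N D ∧
  (∀ i : Fin N, (i : ℕ) ≤ 3 → D (gen F N i) = 0) ∧
  (∀ m : ℕ, (h : m + 5 ≤ N) → D (gen F N ⟨m + 4, by omega⟩) = gen F N ⟨m + 2, by omega⟩)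

/-- The annihilator of a vector under left exterior multiplication is a left ideal. -/
theorem ι_mul_mul_eq_zero {F M : Type*} [CommRing F] [AddCommGroup M] [Module F M]
    (v : M) (a x : ExteriorAlgebra F M) (hx : ExteriorAlgebra.ι F v * x = 0) :
    ExteriorAlgebra.ι F v * (a * x) = 0 := by
  induction a using ExteriorAlgebra.induction generalizing x with
  | algebraMap r => rw [← mul_assoc, ← Algebra.commutes, mul_assoc, hx, mul_zero]
  | ι w =>
    rw [← mul_assoc, eq_neg_of_add_eq_zero_left (ExteriorAlgebra.ι_add_mul_swap v w),
      neg_mul, mul_assoc, hx, mul_zero, neg_zero]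
  | mul a b ha hb => rw [mul_assoc]; exact ha _ (hb _ hx)
  | add a b ha hb => rw [add_mul, mul_add, ha _ hx, hb _ hx, add_zero]

/-- A derivation is annihilated by left multiplication by a vector as soon as this holds on the
generators. -/
theorem IsDeriv.ι_mul_eq_zero {F : Type*} [Field F] {n : ℕ} {D : XA F n →ₗ[F] XA F n}
    (hD : IsDeriv F n D) (v : Fin n → F)
    (hgen : ∀ i, ExteriorAlgebra.ι F v * D (gen F n i) = 0) (ω : XA F n) :
    ExteriorAlgebra.ι F v * D ω = 0 := by
  induction ω using ExteriorAlgebra.induction with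
  | algebraMap r =>
    have h1 : D 1 = 0 := by simpa using hD 1 1
    rw [Algebra.algebraMap_eq_smul_one, map_smul, h1, smul_zero, mul_zero]
  | ι w =>
    have key : LinearMap.mulLeft F (ExteriorAlgebra.ι F v) ∘ₗ D ∘ₗ ExteriorAlgebra.ι F = 0 :=
      (Pi.basisFun F (Fin n)).ext fun i => by simpa [gen] using hgen i
    exact LinearMap.congr_fun key w
  | mul a b ha hb =>
    rw [hD, mul_add, ← mul_assoc, ha, zero_mul, ι_mul_mul_eq_zero v a _ hb, add_zero]
  | add a b ha hb => rw [map_add, mul_add, ha, hb, add_zero]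

/-- In characteristic two, subtracting the square of a derivation from another gives a derivation. -/
theorem IsDeriv.sub_sq {F : Type*} [Field F] [CharP F 2] {n : ℕ} {D₁ D₂ : XA F n →ₗ[F] XA F n}
    (h₁ : IsDeriv F n D₁) (h₂ : IsDeriv F n D₂) : IsDeriv F n (D₂ - D₁ ∘ₗ D₁) := by
  intro a b
  have h : D₁ a * D₁ b + D₁ a * D₁ b = 0 := by
    rw [← two_smul F, CharTwo.two_eq_zero, zero_smul]
  simp only [LinearMap.sub_apply, LinearMap.comp_apply, h₁ _ _, h₂ _ _, map_add, sub_mul, mul_sub]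
  rw [← sub_eq_zero]
  calc _ = -(D₁ a * D₁ b + D₁ a * D₁ b) := by abel
    _ = 0 := by rw [h, neg_zero]

theorem lemma_e2_D2_eq_e2_D1_sq (F : Type*) [Field F] [CharP F 2] (n : ℕ) (hn : 2 ≤ n)
    (D1 D2 : XA F n →ₗ[F] XA F n) (hD1 : IsD1 F n D1) (hD2 : IsD2 F n D2)
    (ω : XA F n) :
    gen F n ⟨1, by omega⟩ * D2 ω = gen F n ⟨1, by omega⟩ * D1 (D1 ω) := by
  rw [← sub_eq_zero, ← mul_sub]
  obtain ⟨hd₁, hz₁, hs₁⟩ := hD1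
  obtain ⟨hd₂, hz₂, hs₂⟩ := hD2
  refine (hd₁.sub_sq hd₂).ι_mul_eq_zero _ ?_ ω
  rintro ⟨i, hi⟩
  change gen F n ⟨1, by omega⟩ * (D2 _ - D1 (D1 _)) = 0
  match i, hi with
  | 0, hi | 1, hi => rw [hz₁ _ (by simp), hz₂ _ (by simp)]; simp
  | 2, hi => rw [hs₁ 0 hi, hz₁ _ (by simp), hz₂ _ (by simp)]; simp
  | 3, hi =>
    rw [hs₁ 1 hi, hs₁ 0 (by omega), hz₂ _ (by simp)]
    simp [gen]
  | m + 4, hi =>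
    rw [hs₁ (m + 2) hi, hs₁ (m + 1) (by omega), hs₂ m hi]
    simp

end Char2Filiform
end
end

section
/- For n ≥ 3, the second Betti number of m0(n) over F equals ⌊(n+1)/2⌋: dim H^2(m0(n)) = ⌊(n+1)/2⌋. -/
/-!
STATEMENT 12: For n ≥ 3, the second Betti number of m0(n) over a field F of
characteristic two equals ⌊(n+1)/2⌋:  dim H^2(m0(n)) = ⌊(n+1)/2⌋.

In characteristic two the Chevalley–Eilenberg complex of alternating forms is
(canonically) the exterior algebra Λ*(e^1,…,e^n) of the dual space, with differential
the derivation determined by its values on the generators; H^k = Z^k / B^k.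
-/

noncomputable section
namespace Char2Filiform

/-- The coordinate functional of index `i`, zero for `i` out of range. -/
def coord (F : Type*) [Field F] (N : ℕ) (i : ℕ) : Module.Dual F (Fin N → F) :=
  if h : i < N then LinearMap.proj ⟨i, h⟩ else 0

/-- The standard basis vector of index `i`, zero for `i` out of range. -/
def basisVec (F : Type*) [Field F] (N : ℕ) (i : ℕ) : Fin N → F :=
  fun j => if (j : ℕ) = i then 1 else 0

/-- The shift `e^{i+1} ↦ e^i`, `e^0 ↦ 0`. -/
def shift (F : Type*) [Field F] (N : ℕ) : (Fin N → F) →ₗ[F] (Fin N → F) :=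
  LinearMap.pi fun i => coord F N (i + 1)

/-- The linear functional on the exterior algebra which pairs a form with `f ∧ g`. -/
def pairing (F : Type*) [Field F] (N : ℕ) (f g : Module.Dual F (Fin N → F)) :
    XA F N →ₗ[F] F :=
  (ExteriorAlgebra.algebraMapInv (R := F) (M := Fin N → F)).toLinearMap ∘ₗ
    CliffordAlgebra.contractLeft g ∘ₗ CliffordAlgebra.contractLeft f

lemma finrank_quotient_comap_subtype {F V : Type*} [Field F] [AddCommGroup V] [Module F V] {m : ℕ}
    (f : V →ₗ[F] (Fin m → F)) {Z B : Submodule F V}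
    (hf : ∀ y, ∃ x ∈ Z, f x = y) (hB : ∀ x ∈ Z, f x = 0 ↔ x ∈ B) :
    Module.finrank F (Z ⧸ B.comap Z.subtype) = m := by
  have hS : B.comap Z.subtype = LinearMap.ker (f.domRestrict Z) := by
    ext x
    exact (hB x x.2).symm
  have hsurj : Function.Surjective (f.domRestrict Z) := fun y =>
    let ⟨x, hx, hxy⟩ := hf y
    ⟨⟨x, hx⟩, hxy⟩
  rw [hS, ((f.domRestrict Z).quotKerEquivOfSurjective hsurj).finrank_eq, Module.finrank_fin_fun]

section Helpers

variable {F : Type*} [Field F] {N : ℕ}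

local notation "ιX" => ExteriorAlgebra.ι F (M := Fin N → F)

lemma gen_eq (i : Fin N) : gen F N i = ιX (basisVec F N i) := by
  unfold gen
  congr 1
  ext j
  simp [basisVec, Pi.single_apply, Fin.ext_iff]

lemma coord_apply_fin (i : Fin N) (v : Fin N → F) : coord F N i v = v i := by
  simp [coord]

lemma coord_of_le {i : ℕ} (h : N ≤ i) : coord F N i = 0 := by
  simp [coord, h]

lemma coord_basisVec (i j : ℕ) (hi : i < N) :
    coord F N i (basisVec F N j) = if i = j then 1 else 0 := by
  simp [coord, hi, basisVec]

lemma coord_basisVec_ne {i j : ℕ} (h : i ≠ j) : coord F N i (basisVec F N j) = 0 := by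
  by_cases hi : i < N
  · simp [coord_basisVec i j hi, h]
  · simp [coord_of_le (not_lt.mp hi)]

lemma coord_shift {i : ℕ} (v : Fin N → F) : coord F N i (shift F N v) = coord F N (i + 1) v := by
  by_cases hi : i < N
  · simp [coord, hi, shift]
  · rw [coord_of_le (not_lt.mp hi), coord_of_le (by omega)]; simp

lemma eq_of_coord {v w : Fin N → F} (h : ∀ i, coord F N i v = coord F N i w) : v = w := by
  ext i
  simpa [coord_apply_fin] using h i

lemma shift_basisVec_succ {i : ℕ} (hi : i + 1 < N) :
    shift F N (basisVec F N (i + 1)) = basisVec F N i := by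
  refine eq_of_coord fun j => ?_
  rw [coord_shift]
  by_cases hj : j = i
  · subst hj
    rw [coord_basisVec _ _ hi, coord_basisVec _ _ (by omega)]
    simp
  · rw [coord_basisVec_ne (by omega), coord_basisVec_ne hj]

lemma shift_basisVec_zero : shift F N (basisVec F N 0) = 0 := by
  refine eq_of_coord fun j => ?_
  rw [coord_shift, coord_basisVec_ne (by omega), map_zero]

lemma pairing_ι_mul_ι (f g : Module.Dual F (Fin N → F)) (v w : Fin N → F) :
    pairing F N f g (ιX v * ιX w) = f v * g w - f w * g v := by
  simp only [pairing, LinearMap.comp_apply, AlgHom.toLinearMap_apply,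
    CliffordAlgebra.contractLeft_ι_mul, CliffordAlgebra.contractLeft_ι, map_sub, map_smul,
    ← Algebra.commutes (f w), ← Algebra.smul_def, smul_eq_mul,
    ExteriorAlgebra.algebraMap_leftInverse (Fin N → F) _]

lemma ι_mul_ι_swap [CharP F 2] (v w : Fin N → F) : ιX v * ιX w = ιX w * ιX v := by
  have h := ExteriorAlgebra.ι_add_mul_swap (R := F) v w
  have h2 : (2 : F) = 0 := CharTwo.two_eq_zero
  have h3 : ιX w * ιX v + ιX w * ιX v = 0 := by
    rw [← two_smul F, h2, zero_smul]
  exact add_right_cancel (h.trans h3.symm)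

lemma pairing_contract (f g h : Module.Dual F (Fin N → F)) (u v w : Fin N → F)
    (hf : f u = 0) (hg : g u = 0) (hh : h u = 1) :
    pairing F N f g (CliffordAlgebra.contractLeft h (ιX u * (ιX v * ιX w))) =
      f v * g w - f w * g v := by
  rw [CliffordAlgebra.contractLeft_ι_mul, CliffordAlgebra.contractLeft_ι_mul,
    CliffordAlgebra.contractLeft_ι, map_sub, hh, one_smul, pairing_ι_mul_ι, mul_sub, map_sub,
    mul_smul_comm, map_smul, pairing_ι_mul_ι, ← Algebra.commutes, ← Algebra.smul_def,
    mul_smul_comm, map_smul, pairing_ι_mul_ι, hf, hg]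
  simp

lemma ι_mul_ι_mem (v w : Fin N → F) : ιX v * ιX w ∈ grade F N 2 := by
  rw [grade, pow_two]
  exact Submodule.mul_mem_mul ⟨v, rfl⟩ ⟨w, rfl⟩

lemma grade_two_induction {P : ∀ x : XA F N, x ∈ grade F N 2 → Prop}
    (hι : ∀ v w, P (ιX v * ιX w) (ι_mul_ι_mem v w))
    (hadd : ∀ x y hx hy, P x hx → P y hy → P (x + y) (add_mem hx hy))
    (x : XA F N) (hx : x ∈ grade F N 2) : P x hx := by
  have hx' := hx
  rw [grade, pow_two] at hx'
  suffices ∃ h, P x h from this.elim fun _ h => h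
  clear hx
  induction hx' using Submodule.mul_induction_on' with
  | mem_mul_mem a ha b hb =>
    obtain ⟨v, rfl⟩ := ha
    obtain ⟨w, rfl⟩ := hb
    exact ⟨_, hι v w⟩
  | add x _ y _ ihx ihy =>
    obtain ⟨hx, hPx⟩ := ihx
    obtain ⟨hy, hPy⟩ := ihy
    exact ⟨_, hadd x y hx hy hPx hPy⟩

lemma sum_coord_smul_basisVec (v : Fin N → F) :
    v = ∑ i ∈ Finset.range N, coord F N i v • basisVec F N i := by
  refine eq_of_coord fun j => ?_
  rw [map_sum]
  by_cases hj : j < N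
  · simp [coord_basisVec j _ hj, hj]
  · simp [coord_of_le (not_lt.mp hj)]

lemma eq_sum_pairing {x : XA F N} (hx : x ∈ grade F N 2) :
    x = ∑ i ∈ Finset.range N, ∑ j ∈ Finset.range N,
      (if i < j then pairing F N (coord F N i) (coord F N j) x else 0) •
        (ιX (basisVec F N i) * ιX (basisVec F N j)) := by
  induction x, hx using grade_two_induction with
  | hι v w =>
    let T : ℕ → ℕ → XA F N := fun i j => (coord F N i v * coord F N j w) •
      (ιX (basisVec F N i) * ιX (basisVec F N j))
    have hexp : ιX v * ιX w = ∑ i ∈ Finset.range N, ∑ j ∈ Finset.range N, T i j := by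
      conv_lhs => rw [sum_coord_smul_basisVec v, sum_coord_smul_basisVec w]
      simp only [map_sum, map_smul, Finset.sum_mul_sum, smul_mul_smul_comm, T]
    have hsplit : ∀ i j, T i j = (if i < j then T i j else 0) + (if j < i then T i j else 0) := by
      intro i j
      obtain h | rfl | h := lt_trichotomy i j
      · simp [h, h.le]
      · simp [T]
      · simp [h, h.le]
    conv_lhs =>
      rw [hexp, Finset.sum_congr rfl fun i _ => Finset.sum_congr rfl fun j _ => hsplit i j]
    simp only [Finset.sum_add_distrib]
    rw [Finset.sum_comm (f := fun i j => if j < i then T i j else 0)]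
    simp only [← Finset.sum_add_distrib]
    refine Finset.sum_congr rfl fun i _ => Finset.sum_congr rfl fun j _ => ?_
    split_ifs
    · have hswap : ιX (basisVec F N j) * ιX (basisVec F N i) =
          -(ιX (basisVec F N i) * ιX (basisVec F N j)) :=
        eq_neg_of_add_eq_zero_left (ExteriorAlgebra.ι_add_mul_swap _ _)
      rw [pairing_ι_mul_ι, sub_smul, sub_eq_add_neg]
      simp only [T, hswap, smul_neg, mul_comm (coord F N j v)]
    · simp
  | hadd x y _ _ hx hy =>
    conv_lhs => rw [hx, hy]
    simp only [← Finset.sum_add_distrib, ← add_smul, map_add, ite_add_ite, add_zero]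

/-- A two-form without component in `Λ²(e^1,…,e^{N-1})` is a multiple of `e^0`. -/
lemma eq_basisVec_zero_mul {x : XA F N} (hx : x ∈ grade F N 2)
    (h : ∀ i j, pairing F N (coord F N (i + 1)) (coord F N (j + 1)) x = 0) :
    ∃ u, x = ιX (basisVec F N 0) * ιX u ∧
      ∀ j, 0 < j → coord F N j u = pairing F N (coord F N 0) (coord F N j) x := by
  refine ⟨∑ j ∈ Finset.range N, (if 0 < j then pairing F N (coord F N 0) (coord F N j) x else 0) •
    basisVec F N j, ?_, fun j hj => ?_⟩
  · conv_lhs => rw [eq_sum_pairing hx]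
    cases N with
    | zero => simp [Subsingleton.elim (basisVec F 0 0) 0]
    | succ M =>
      rw [Finset.sum_range_succ', Finset.sum_eq_zero, zero_add]
      · simp only [map_sum, map_smul, Finset.mul_sum, mul_smul_comm]
      · refine fun i _ => Finset.sum_eq_zero fun j _ => ?_
        cases j <;> simp [h]
  · rw [map_sum]
    by_cases hjN : j < N
    · simp only [map_smul, coord_basisVec j _ hjN]
      simp [hjN, hj]
    · simp [coord_of_le (not_lt.mp hjN), pairing]

lemma d_ι {d : XA F N →ₗ[F] XA F N} (hd : Isd0 F N d) (v : Fin N → F) :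
    d (ιX v) = ιX (basisVec F N 0) * ιX (shift F N v) := by
  have key : ∀ i < N, d (ιX (basisVec F N i)) =
      ιX (basisVec F N 0) * ιX (shift F N (basisVec F N i)) := by
    intro i hi
    match i, hi with
    | 0, hi =>
      have := hd.2.1 ⟨0, hi⟩ (by simp)
      rw [gen_eq] at this
      rw [this, shift_basisVec_zero]; simp
    | 1, hi =>
      have := hd.2.1 ⟨1, hi⟩ (by simp)
      rw [gen_eq] at this
      rw [this, shift_basisVec_succ hi]; simp
    | m + 2, hi =>
      have := hd.2.2 m hi
      simp only [gen_eq] at this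
      rw [this, shift_basisVec_succ hi]
  rw [sum_coord_smul_basisVec v]
  simp only [map_sum, map_smul, Finset.mul_sum, mul_smul_comm]
  exact Finset.sum_congr rfl fun i hi => by rw [key i (Finset.mem_range.mp hi)]

lemma d_ι_mul_ι [CharP F 2] {d : XA F N →ₗ[F] XA F N} (hd : Isd0 F N d) (v w : Fin N → F) :
    d (ιX v * ιX w) = ιX (basisVec F N 0) * (ιX (shift F N v) * ιX w) +
      ιX (basisVec F N 0) * (ιX v * ιX (shift F N w)) := by
  rw [hd.1, d_ι hd, d_ι hd, mul_assoc, ← mul_assoc (ιX v), ι_mul_ι_swap v (basisVec F N 0),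
    mul_assoc]

lemma pairing_d [CharP F 2] {d : XA F N →ₗ[F] XA F N} (hd : Isd0 F N d) (hN : 0 < N)
    {x : XA F N} (hx : x ∈ grade F N 2) (p q : ℕ) (hp : p ≠ 0) (hq : q ≠ 0) :
    pairing F N (coord F N p) (coord F N q) (CliffordAlgebra.contractLeft (coord F N 0) (d x)) =
      pairing F N (coord F N (p + 1)) (coord F N q) x +
        pairing F N (coord F N p) (coord F N (q + 1)) x := by
  induction x, hx using grade_two_induction with
  | hι v w =>
    have h0 : coord F N 0 (basisVec F N 0) = 1 := by simp [coord_basisVec 0 0 hN]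
    rw [d_ι_mul_ι hd, map_add, map_add,
      pairing_contract _ _ _ _ _ _ (coord_basisVec_ne hp) (coord_basisVec_ne hq) h0,
      pairing_contract _ _ _ _ _ _ (coord_basisVec_ne hp) (coord_basisVec_ne hq) h0,
      pairing_ι_mul_ι, pairing_ι_mul_ι]
    simp only [coord_shift]
    ring
  | hadd x y _ _ hx hy =>
    simp only [map_add, hx, hy]
    ring

/-- The antidiagonal recursion satisfied by the coefficients of a two-cocycle. -/
lemma eq_zero_of_antidiagonal {a : ℕ → ℕ → F}
    (hrec : ∀ p q, p ≠ 0 → q ≠ 0 → a (p + 1) q + a p (q + 1) = 0)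
    (hdiag : ∀ p, a p p = 0) (heven : ∀ k, k ≠ 0 → a 1 (2 * k) = 0) (i j : ℕ) :
    a (i + 1) (j + 1) = 0 := by
  have hshift : ∀ t q, q ≠ 0 → (a (t + 1) q = 0 ↔ a 1 (q + t) = 0) := by
    intro t
    induction t with
    | zero => simp
    | succ t ih =>
      intro q hq
      rw [eq_neg_of_add_eq_zero_left (hrec (t + 1) q (by omega) hq), neg_eq_zero,
        ih (q + 1) (by omega), add_right_comm, add_assoc]
  rw [hshift i (j + 1) (by omega)]
  obtain ⟨k, hk⟩ | ⟨k, hk⟩ := Nat.even_or_odd (j + 1 + i)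
  · rw [hk, ← two_mul]
    exact heven k (by omega)
  · rw [hk, show 2 * k + 1 = (k + 1) + k by ring, ← hshift k (k + 1) (by omega)]
    exact hdiag _

lemma pairing_self {x : XA F N} (hx : x ∈ grade F N 2) (f : Module.Dual F (Fin N → F)) :
    pairing F N f f x = 0 := by
  induction x, hx using grade_two_induction with
  | hι v w =>
    rw [pairing_ι_mul_ι]; ring
  | hadd x y _ _ hx hy => rw [map_add, hx, hy, add_zero]

/-- Coefficients of a two-form at `e^0 ∧ e^{N-1}` and at `e^1 ∧ e^{2k}` for `k ≥ 1`. They are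
coordinates on the second cohomology. -/
def classCoeff (F : Type*) [Field F] (N : ℕ) : XA F N →ₗ[F] (Fin ((N + 1) / 2) → F) :=
  LinearMap.pi fun k => if (k : ℕ) = 0 then pairing F N (coord F N 0) (coord F N (N - 1))
    else pairing F N (coord F N 1) (coord F N (2 * k))

lemma classCoeff_eq_zero_iff [CharP F 2] {d : XA F N →ₗ[F] XA F N} (hd : Isd0 F N d)
    (hN : 3 ≤ N) {x : XA F N} (hx : x ∈ cocycles F N d 2) :
    classCoeff F N x = 0 ↔ x ∈ coboundaries F N d 2 := by
  constructor
  · intro h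
    obtain ⟨hx2, hdx⟩ := hx
    have hcoeff : ∀ i j, pairing F N (coord F N (i + 1)) (coord F N (j + 1)) x = 0 := by
      refine eq_zero_of_antidiagonal
        (a := fun i j => pairing F N (coord F N i) (coord F N j) x) ?_ ?_ ?_
      · intro p q hp hq
        rw [← pairing_d hd (by omega) hx2 p q hp hq, LinearMap.mem_ker.mp hdx]
        simp
      · exact fun p => pairing_self hx2 _
      · intro k hk
        by_cases hkN : k < (N + 1) / 2
        · simpa [classCoeff, hk] using congrFun h ⟨k, hkN⟩
        · simp [coord_of_le (F := F) (N := N) (i := 2 * k) (by omega), pairing]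
    obtain ⟨u, rfl, hu⟩ := eq_basisVec_zero_mul hx2 hcoeff
    have hlast : coord F N (N - 1) u = 0 := by
      rw [hu _ (by omega)]
      simpa [classCoeff] using congrFun h ⟨0, by omega⟩
    refine ⟨ιX (fun j => if (j : ℕ) = 0 then 0 else coord F N (j - 1) u), ?_, ?_⟩
    · rw [grade, pow_one]
      exact ⟨_, rfl⟩
    · rw [d_ι hd]
      congr 2
      refine eq_of_coord fun i => ?_
      rw [coord_shift]
      obtain hi | rfl | hi : i + 1 < N ∨ i = N - 1 ∨ N ≤ i := by omega
      · simp [coord, hi]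
      · rw [hlast, coord_of_le (by omega), LinearMap.zero_apply]
      · rw [coord_of_le hi, coord_of_le (by omega : N ≤ i + 1)]
        simp
  · rintro ⟨y, hy, rfl⟩
    rw [grade, pow_one] at hy
    obtain ⟨v, rfl⟩ := hy
    rw [d_ι hd]
    ext k
    by_cases hk : (k : ℕ) = 0
    · simp only [classCoeff, LinearMap.pi_apply, hk, if_true, pairing_ι_mul_ι, coord_shift,
        Nat.sub_add_cancel (by omega : 1 ≤ N), coord_of_le le_rfl,
        coord_basisVec_ne (F := F) (N := N) (by omega : N - 1 ≠ 0)]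
      simp
    · simp only [classCoeff, LinearMap.pi_apply, hk, if_false, pairing_ι_mul_ι,
        coord_basisVec_ne (F := F) (N := N) one_ne_zero,
        coord_basisVec_ne (F := F) (N := N) (by omega : 2 * (k : ℕ) ≠ 0)]
      simp

/-- The cocycle `∑_{i=1}^{k} e^i ∧ e^{2k+1-i}`. -/
def oddCocycle (F : Type*) [Field F] (N k : ℕ) : XA F N :=
  ∑ i ∈ Finset.range k, ExteriorAlgebra.ι F (basisVec F N (i + 1)) *
    ExteriorAlgebra.ι F (basisVec F N (2 * k - i))

lemma oddCocycle_mem [CharP F 2] {d : XA F N →ₗ[F] XA F N} (hd : Isd0 F N d) {k : ℕ}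
    (hk : 2 * k < N) : oddCocycle F N k ∈ cocycles F N d 2 := by
  refine ⟨Submodule.sum_mem _ fun i _ => ι_mul_ι_mem _ _, ?_⟩
  change d (oddCocycle F N k) = 0
  rw [oddCocycle, map_sum]
  have h2 : (2 : F) = 0 := CharTwo.two_eq_zero
  have hself : ∀ z : XA F N, z + z = 0 := fun z => by rw [← two_smul F, h2, zero_smul]
  have key : ∀ m ≤ k, ∑ i ∈ Finset.range m, d (ιX (basisVec F N (i + 1)) *
      ιX (basisVec F N (2 * k - i))) =
      ιX (basisVec F N 0) * (ιX (basisVec F N m) * ιX (basisVec F N (2 * k - m))) := by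
    intro m hm
    induction m with
    | zero => rw [← mul_assoc]; simp
    | succ m ih =>
      rw [Finset.sum_range_succ, ih (by omega), d_ι_mul_ι hd, shift_basisVec_succ (by omega),
        show 2 * k - m = (2 * k - (m + 1)) + 1 by omega, shift_basisVec_succ (by omega),
        ← add_assoc, hself, zero_add]
  rw [key k le_rfl, two_mul, Nat.add_sub_cancel]
  simp

lemma classCoeff_oddCocycle (k : Fin ((N + 1) / 2)) (hk : (k : ℕ) ≠ 0) :
    classCoeff F N (oddCocycle F N k) = Pi.single k 1 := by
  obtain ⟨k, hkN⟩ := k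
  replace hk : k ≠ 0 := hk
  ext ⟨l, hl⟩
  by_cases hl0 : l = 0
  · subst hl0
    rw [Pi.single_eq_of_ne (by simp [hk.symm])]
    simp only [classCoeff, oddCocycle, LinearMap.pi_apply, if_true, map_sum, pairing_ι_mul_ι]
    refine Finset.sum_eq_zero fun i hi => ?_
    rw [Finset.mem_range] at hi
    rw [coord_basisVec_ne (by omega : 0 ≠ i + 1), coord_basisVec_ne (by omega : 0 ≠ 2 * k - i)]
    ring
  · simp only [classCoeff, oddCocycle, LinearMap.pi_apply, hl0, if_false, map_sum,
      pairing_ι_mul_ι]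
    rw [Finset.sum_eq_single 0]
    · rw [coord_basisVec_ne (F := F) (by omega : 1 ≠ 2 * k - 0), zero_mul, sub_zero, zero_add,
        coord_basisVec 1 1 (by omega), coord_basisVec _ _ (by omega), Pi.single_apply]
      simp
    · intro i hi hi0
      rw [Finset.mem_range] at hi
      rw [coord_basisVec_ne (F := F) (by omega : 1 ≠ i + 1),
        coord_basisVec_ne (F := F) (by omega : 1 ≠ 2 * k - i)]
      ring
    · simp [hk]

lemma classCoeff_top (hN : 3 ≤ N) :
    classCoeff F N (ιX (basisVec F N 0) * ιX (basisVec F N (N - 1))) =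
      Pi.single ⟨0, by omega⟩ 1 := by
  ext k
  by_cases hk : (k : ℕ) = 0
  · obtain ⟨k, hkN⟩ := k
    obtain rfl : k = 0 := hk
    simp [classCoeff, pairing_ι_mul_ι, coord_basisVec 0 0 (by omega : 0 < N),
      coord_basisVec (F := F) (N - 1) (N - 1) (by omega : N - 1 < N),
      coord_basisVec_ne (F := F) (N := N) (by omega : N - 1 ≠ 0)]
  · rw [Pi.single_eq_of_ne (fun h => hk (by simp [h]))]
    simp [classCoeff, hk, pairing_ι_mul_ι,
      coord_basisVec_ne (F := F) (N := N) one_ne_zero,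
      coord_basisVec_ne (F := F) (N := N) (by omega : 2 * (k : ℕ) ≠ 0)]

lemma classCoeff_domRestrict_surjective [CharP F 2] {d : XA F N →ₗ[F] XA F N}
    (hd : Isd0 F N d) (hN : 3 ≤ N) :
    Function.Surjective ((classCoeff F N).domRestrict (cocycles F N d 2)) := by
  rw [← LinearMap.range_eq_top, ← top_le_iff, ← (Pi.basisFun F _).span_eq, Submodule.span_le]
  rintro _ ⟨k, rfl⟩
  rw [Pi.basisFun_apply]
  by_cases hk : (k : ℕ) = 0
  · obtain ⟨k, hkN⟩ := k
    obtain rfl : k = 0 := hk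
    refine ⟨⟨ιX (basisVec F N 0) * ιX (basisVec F N (N - 1)), ι_mul_ι_mem _ _, ?_⟩,
      classCoeff_top hN⟩
    change d _ = 0
    rw [d_ι_mul_ι hd, shift_basisVec_zero, ← mul_assoc _ (ιX _) (ιX (shift F N _))]
    simp
  · exact ⟨⟨oddCocycle F N k, oddCocycle_mem hd (by omega)⟩, classCoeff_oddCocycle k hk⟩

end Helpers

theorem b2_m0 (F : Type*) [Field F] [CharP F 2] (n : ℕ) (hn : 3 ≤ n)
    (d0 : XA F n →ₗ[F] XA F n) (hd0 : Isd0 F n d0) (hd0sq : ∀ a, d0 (d0 a) = 0) :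
    bettiNumber F n d0 2 = (n + 1) / 2 := by
  refine finrank_quotient_comap_subtype (classCoeff F n) (fun y => ?_)
    fun x hx => classCoeff_eq_zero_iff hd0 hn hx
  obtain ⟨x, hx⟩ := classCoeff_domRestrict_surjective hd0 hn y
  exact ⟨x, x.2, hx⟩

end Char2Filiform
end
end
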